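/- Let n ≥ 3, let X = X₁×X₂×···×X_n be a product of Polish spaces, let P ∈ P(X) with H(P|R) < ∞ and let R ∈ P(X) be Markovian. Then equality H(P|R) = Σ_{i=1}^{n−1} H(P_{i,i+1}|R_{i,i+1}) − Σ_{i=2}^{n−1} H(P_i|R_i) holds if and only if P is itself Markovian, i.e. P = P_{1,2} ∘ P_{2,3} ∘ ··· ∘ P_{n−1,n}. -/

import Mathlib

open MeasureTheory ProbabilityTheory Filter Set
open scoped ENNReal NNReal BigOperators Topology Classical

noncomputable section

section MarkovConcat

variable {Y₁ Y₂ Y₃ : Type*}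
  [MeasurableSpace Y₁] [TopologicalSpace Y₁] [PolishSpace Y₁] [BorelSpace Y₁] [Nonempty Y₁]
  [MeasurableSpace Y₂] [TopologicalSpace Y₂] [PolishSpace Y₂] [BorelSpace Y₂] [Nonempty Y₂]
  [MeasurableSpace Y₃] [TopologicalSpace Y₃] [PolishSpace Y₃] [BorelSpace Y₃] [Nonempty Y₃]

/-- Markov concatenation of `P₁₂ ∈ P(Y₁×Y₂)` and `P₂₃ ∈ P(Y₂×Y₃)`:
`(P₁₂ ∘ P₂₃)(dy₁ dy₂ dy₃) = P₁₂(dy₁|y₂) P₂(dy₂) P₂₃(dy₃|y₂)`, where `P₂ = (P₁₂)₂`. -/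
def markovConcat (P12 : Measure (Y₁ × Y₂)) (P23 : Measure (Y₂ × Y₃))
    [IsFiniteMeasure P12] [IsFiniteMeasure P23] : Measure (Y₁ × Y₂ × Y₃) :=
  ((P12.map Prod.snd) ⊗ₘ ((P12.map Prod.swap).condKernel ×ₖ P23.condKernel)).map
    fun p => (p.2.1, p.1, p.2.2)

end MarkovConcat

section Markovian

variable {X : ℕ → Type*} [∀ i, MeasurableSpace (X i)] [∀ i, TopologicalSpace (X i)]
  [∀ i, PolishSpace (X i)] [∀ i, BorelSpace (X i)] [∀ i, Nonempty (X i)]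

/-- Evaluation of `ω ∈ X₀ × ⋯ × X_{n-1}` at coordinate `i` (junk value if `i ≥ n`). -/
def coordFun {n : ℕ} (ω : ∀ j : Fin n, X j) (i : ℕ) : X i :=
  if h : i < n then ω ⟨i, h⟩ else Nonempty.some inferInstance

theorem measurable_coordFun {n i : ℕ} :
    Measurable fun ω : ∀ j : Fin n, X j => coordFun ω i := by
  unfold coordFun
  by_cases h : i < n
  · simp only [dif_pos h]; exact measurable_pi_apply _
  · simp only [dif_neg h]; exact measurable_const

/-- Projection onto the first `i` coordinates. -/
def frontFun {n : ℕ} (i : ℕ) (h : i ≤ n) (ω : ∀ j : Fin n, X j) : ∀ j : Fin i, X j :=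
  fun j => ω (Fin.castLE h j)

/-- Marginal of `Q` on the first `i` coordinates. -/
def frontMarg {n : ℕ} (Q : Measure (∀ j : Fin n, X j)) (i : ℕ) (h : i ≤ n) :
    Measure (∀ j : Fin i, X j) :=
  Q.map (frontFun i h)

/-- Marginal of `Q` on the first `i` coordinates together with the `i`-th coordinate,
seen as a measure on a product of two factors. -/
def frontPairMarg {n : ℕ} (Q : Measure (∀ j : Fin n, X j)) (i : ℕ) (h : i < n) :
    Measure ((∀ j : Fin i, X j) × X i) :=
  Q.map fun ω => (frontFun i h.le ω, coordFun ω i)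

/-- Marginal of `Q` on the pair of adjacent coordinates `(i-1, i)`. -/
def adjMarg {n : ℕ} (Q : Measure (∀ j : Fin n, X j)) (i : ℕ) :
    Measure (X (i - 1) × X i) :=
  Q.map fun ω => (coordFun ω (i - 1), coordFun ω i)

instance frontMarg.instIsFiniteMeasure {n : ℕ} (Q : Measure (∀ j : Fin n, X j))
    [IsFiniteMeasure Q] (i : ℕ) (h : i ≤ n) : IsFiniteMeasure (frontMarg Q i h) := by
  unfold frontMarg; infer_instance

instance frontPairMarg.instIsFiniteMeasure {n : ℕ} (Q : Measure (∀ j : Fin n, X j))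
    [IsFiniteMeasure Q] (i : ℕ) (h : i < n) : IsFiniteMeasure (frontPairMarg Q i h) := by
  unfold frontPairMarg; infer_instance

instance adjMarg.instIsFiniteMeasure {n : ℕ} (Q : Measure (∀ j : Fin n, X j))
    [IsFiniteMeasure Q] (i : ℕ) : IsFiniteMeasure (adjMarg Q i) := by
  unfold adjMarg; infer_instance

set_option synthInstance.maxHeartbeats 1000000 in
/-- `Q ∈ P(X₀ × ⋯ × X_{n-1})` is Markovian: for every `i` (0-indexed, `2 ≤ i ≤ n-1`), the
conditional law of the `i`-th coordinate given the previous ones coincides with its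
conditional law given the `(i-1)`-th coordinate, i.e. the law of the first `i+1` coordinates
is the composition of the law of the first `i` coordinates with the kernel
`(x₀,…,x_{i-1}) ↦ Q_{i-1,i}(· | x_{i-1})`. -/
def IsMarkovian {n : ℕ} (Q : Measure (∀ j : Fin n, X j)) [IsFiniteMeasure Q] : Prop :=
  ∀ i : ℕ, 2 ≤ i → ∀ hn : i < n,
    frontPairMarg Q i hn =
      (frontMarg Q i hn.le) ⊗ₘ
        ((adjMarg Q i).condKernel.comap
          (fun x : ∀ j : Fin i, X j => coordFun x (i - 1)) measurable_coordFun)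

end Markovian

/-- Relative entropy `H(q|r)`, valued in `EReal`: it is `∫ log (dq/dr) dq` if `q ≪ r` and the
log-likelihood ratio is `q`-integrable, and `+∞` otherwise. -/
def relEnt {Z : Type*} [MeasurableSpace Z] (q r : Measure Z) : EReal :=
  if q ≪ r ∧ Integrable (llr q r) q then ((∫ x, llr q r x ∂q : ℝ) : EReal) else ⊤

section Marginals

variable {X : ℕ → Type*} [∀ i, MeasurableSpace (X i)] [∀ i, TopologicalSpace (X i)]
  [∀ i, PolishSpace (X i)] [∀ i, BorelSpace (X i)] [∀ i, Nonempty (X i)]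

/-- Marginal of `Q` on the `i`-th coordinate. -/
def singleMarg {n : ℕ} (Q : Measure (∀ j : Fin n, X j)) (i : ℕ) : Measure (X i) :=
  Q.map fun ω => coordFun ω i

/-- Marginal of `Q` on the pair of coordinates `(i, i+1)`. -/
def pairMarg {n : ℕ} (Q : Measure (∀ j : Fin n, X j)) (i : ℕ) :
    Measure (X i × X (i + 1)) :=
  Q.map fun ω => (coordFun ω i, coordFun ω (i + 1))

end Marginals

section KullbackLeibler

open InformationTheory

variable {A B C : Type*} [MeasurableSpace A] [MeasurableSpace B] [MeasurableSpace C]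

theorem klDiv_map_of_measurableEmbedding {f : A → B} (hf : MeasurableEmbedding f)
    (μ ν : Measure A) [IsFiniteMeasure μ] [IsFiniteMeasure ν] :
    klDiv (μ.map f) (ν.map f) = klDiv μ ν := by
  refine le_antisymm (klDiv_map_le μ ν hf.measurable) ?_
  rcases isEmpty_or_nonempty A with hA | hA
  · rw [Measure.eq_zero_of_isEmpty μ, Measure.eq_zero_of_isEmpty ν]
    simp
  · have h := klDiv_map_le (μ.map f) (ν.map f) hf.measurable_invFun
    rwa [Measure.map_map hf.measurable_invFun hf.measurable,
      Measure.map_map hf.measurable_invFun hf.measurable,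
      hf.leftInverse_invFun.comp_eq_id, Measure.map_id, Measure.map_id] at h

theorem klDiv_compProd_right_eq_add [StandardBorelSpace C] [Nonempty C]
    (ρ : Measure (A × C)) (ν : Measure A) (η : Kernel A C)
    [IsFiniteMeasure ρ] [IsFiniteMeasure ν] [IsMarkovKernel η] :
    klDiv ρ (ν ⊗ₘ η) = klDiv ρ.fst ν + klDiv ρ (ρ.fst ⊗ₘ η) := by
  have h := klDiv_compProd_eq_add (μ := ρ.fst) (ν := ν) (κ := ρ.condKernel) (η := η)
  rwa [ρ.disintegrate ρ.condKernel] at h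

theorem compProd_compProd_comap_fst_swap (m : Measure B) [SFinite m]
    (κ : Kernel B C) (ς : Kernel B A) [IsSFiniteKernel κ] [IsSFiniteKernel ς] :
    ((m ⊗ₘ ς) ⊗ₘ κ.comap Prod.fst measurable_fst).map (fun p => ((p.1.1, p.2), p.1.2)) =
      (m ⊗ₘ κ) ⊗ₘ ς.comap Prod.fst measurable_fst := by
  refine Measure.ext_of_lintegral _ fun f hf => ?_
  rw [lintegral_map hf (by fun_prop), Measure.lintegral_compProd (by fun_prop),
    Measure.lintegral_compProd (by fun_prop), Measure.lintegral_compProd hf,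
    Measure.lintegral_compProd (by fun_prop)]
  refine lintegral_congr fun b => ?_
  simp only [Kernel.comap_apply]
  exact lintegral_lintegral_swap (by fun_prop)

/-- The defect between the relative entropies of a joint law and of its marginals, relative to a
law under which `c` depends on `(b, a)` only through `b`. -/
theorem klDiv_add_klDiv_fst_fst_eq [StandardBorelSpace A] [Nonempty A]
    [StandardBorelSpace C] [Nonempty C]
    (P R : Measure ((B × A) × C)) [IsFiniteMeasure P] [IsFiniteMeasure R]
    (κ : Kernel B C) [IsMarkovKernel κ]
    (hR : R = R.fst ⊗ₘ κ.comap Prod.fst measurable_fst) :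
    klDiv P R + klDiv P.fst.fst R.fst.fst =
      klDiv (P.map fun p => (p.1.1, p.2)) (R.map fun p => (p.1.1, p.2)) + klDiv P.fst R.fst +
        klDiv P (P.fst ⊗ₘ
          (P.map fun p => (p.1.1, p.2)).condKernel.comap Prod.fst measurable_fst) := by
  set Φ : (B × A) × C → (B × C) × A := fun p => ((p.1.1, p.2), p.1.2) with hΦ
  have hΦm : Measurable Φ := by fun_prop
  have hΦe : MeasurableEmbedding Φ :=
    MeasurableEquiv.measurableEmbedding
      { toFun := Φ
        invFun := fun p => ((p.1.1, p.2), p.1.2)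
        left_inv := fun _ => rfl
        right_inv := fun _ => rfl
        measurable_toFun := hΦm
        measurable_invFun := show Measurable fun p : (B × C) × A => ((p.1.1, p.2), p.1.2) by
          fun_prop }
  have hfst (Q : Measure ((B × A) × C)) : (Q.map Φ).fst = Q.map fun p => (p.1.1, p.2) :=
    Measure.map_map measurable_fst hΦm
  have hfst_fst (Q : Measure ((B × A) × C)) :
      (Q.map fun p => (p.1.1, p.2)).fst = Q.fst.fst := by
    simp only [Measure.fst]
    rw [Measure.map_map (by fun_prop) (by fun_prop), Measure.map_map (by fun_prop) (by fun_prop)]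
    rfl
  set πP := P.map fun p => (p.1.1, p.2) with hπP
  set ς := R.fst.condKernel
  have hRΦ : R.map Φ = (R.fst.fst ⊗ₘ κ) ⊗ₘ ς.comap Prod.fst measurable_fst := by
    conv_lhs => rw [hR, ← R.fst.disintegrate ς]
    exact compProd_compProd_comap_fst_swap _ _ _
  have hπR : (R.map fun p => (p.1.1, p.2)) = R.fst.fst ⊗ₘ κ := by
    rw [← hfst, hRΦ, Measure.fst_compProd]
  have hmix : πP ⊗ₘ ς.comap Prod.fst measurable_fst =
      ((P.fst.fst ⊗ₘ ς) ⊗ₘ πP.condKernel.comap Prod.fst measurable_fst).map Φ := by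
    conv_lhs => rw [← πP.disintegrate πP.condKernel, hfst_fst]
    exact (compProd_compProd_comap_fst_swap _ _ _).symm
  have h₁ : klDiv P R = klDiv πP (R.map fun p => (p.1.1, p.2)) +
      (klDiv P.fst (P.fst.fst ⊗ₘ ς) +
        klDiv P (P.fst ⊗ₘ πP.condKernel.comap Prod.fst measurable_fst)) := by
    rw [← klDiv_map_of_measurableEmbedding hΦe P R, hRΦ, klDiv_compProd_right_eq_add, hfst,
      hmix, klDiv_map_of_measurableEmbedding hΦe, klDiv_compProd_right_eq_add P, hπR]
  have h₂ : klDiv P.fst R.fst = klDiv P.fst.fst R.fst.fst + klDiv P.fst (P.fst.fst ⊗ₘ ς) := by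
    conv_lhs => rw [← R.fst.disintegrate ς]
    exact klDiv_compProd_right_eq_add _ _ _
  rw [h₁, h₂]
  ring

theorem map_fst_compProd_comap (μ : Measure A) [SFinite μ] {g : A → B} (hg : Measurable g)
    (κ : Kernel B C) [IsSFiniteKernel κ] :
    (μ ⊗ₘ κ.comap g hg).map (fun p => ((g p.1, p.1), p.2)) =
      μ.map (fun a => (g a, a)) ⊗ₘ κ.comap Prod.fst measurable_fst := by
  refine Measure.ext_of_lintegral _ fun f hf => ?_
  rw [lintegral_map hf (by fun_prop), Measure.lintegral_compProd (by fun_prop),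
    Measure.lintegral_compProd hf, lintegral_map (by fun_prop) (by fun_prop)]
  rfl

theorem klDiv_add_klDiv_map_fst_eq [StandardBorelSpace A] [Nonempty A]
    [StandardBorelSpace B] [StandardBorelSpace C] [Nonempty C]
    (P R : Measure (A × C)) [IsFiniteMeasure P] [IsFiniteMeasure R]
    {g : A → B} (hg : Measurable g) (κ : Kernel B C) [IsMarkovKernel κ]
    (hR : R = R.fst ⊗ₘ κ.comap g hg) :
    klDiv P R + klDiv (P.fst.map g) (R.fst.map g) =
      klDiv (P.map fun p => (g p.1, p.2)) (R.map fun p => (g p.1, p.2)) + klDiv P.fst R.fst +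
        klDiv P (P.fst ⊗ₘ (P.map fun p => (g p.1, p.2)).condKernel.comap g hg) := by
  have hΨ : MeasurableEmbedding fun p : A × C => ((g p.1, p.1), p.2) :=
    Measurable.measurableEmbedding (by fun_prop) fun p q h => by
      simp only [Prod.mk.injEq] at h
      exact Prod.ext h.1.2 h.2
  have hψ : MeasurableEmbedding fun a : A => (g a, a) :=
    Measurable.measurableEmbedding (by fun_prop) fun p q h => (Prod.mk.inj h).2
  have hfst (Q : Measure (A × C)) :
      (Q.map fun p => ((g p.1, p.1), p.2)).fst = Q.fst.map fun a => (g a, a) := by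
    simp only [Measure.fst]
    rw [Measure.map_map (by fun_prop) (by fun_prop), Measure.map_map (by fun_prop) (by fun_prop)]
    rfl
  have hfst_fst (Q : Measure A) : (Q.map fun a => (g a, a)).fst = Q.map g :=
    Measure.map_map measurable_fst hψ.measurable
  have hpair (Q : Measure (A × C)) :
      (Q.map fun p => ((g p.1, p.1), p.2)).map (fun p => (p.1.1, p.2)) =
        Q.map fun p => (g p.1, p.2) :=
    Measure.map_map (by fun_prop) (by fun_prop)
  have h := klDiv_add_klDiv_fst_fst_eq (P.map fun p => ((g p.1, p.1), p.2))
    (R.map fun p => ((g p.1, p.1), p.2)) κ (by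
      rw [hfst, ← map_fst_compProd_comap _ hg, ← hR])
  simp only [hpair] at h
  rwa [hfst, hfst, hfst_fst, hfst_fst, ← map_fst_compProd_comap _ hg,
    klDiv_map_of_measurableEmbedding hΨ, klDiv_map_of_measurableEmbedding hψ,
    klDiv_map_of_measurableEmbedding hΨ] at h

end KullbackLeibler
open InformationTheory in
theorem relEnt_eq_klDiv {Z : Type*} [MeasurableSpace Z] (q r : Measure Z)
    [IsProbabilityMeasure q] [IsProbabilityMeasure r] :
    relEnt q r = (klDiv q r : EReal) := by
  unfold relEnt
  split_ifs with h
  · rw [← toReal_klDiv_of_measure_eq h.1 (by simp)]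
    rw [← EReal.toReal_coe_ennreal,
      EReal.coe_toReal (by simpa using klDiv_ne_top h.1 h.2) (by simp)]
  · rw [klDiv_def, if_neg h]
    rfl

theorem measurable_frontFun {X : ℕ → Type*} [∀ i, MeasurableSpace (X i)] {n i : ℕ} (h : i ≤ n) :
    Measurable (frontFun (X := X) i h) := by
  unfold frontFun
  fun_prop

theorem frontMarg_self {X : ℕ → Type*} [∀ i, MeasurableSpace (X i)] {n : ℕ}
    (Q : Measure (∀ j : Fin n, X j)) : frontMarg Q n le_rfl = Q :=
  Measure.map_id

theorem coordFun_frontFun {X : ℕ → Type*} [∀ i, Nonempty (X i)] {n i k : ℕ} (h : i ≤ n)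
    (hk : k < i) (ω : ∀ j : Fin n, X j) :
    coordFun (frontFun i h ω) k = coordFun ω k := by
  simp only [coordFun, dif_pos hk, dif_pos (hk.trans_le h)]
  rfl

section Marginals

open InformationTheory

variable {X : ℕ → Type*} [∀ i, MeasurableSpace (X i)] [∀ i, TopologicalSpace (X i)]
  [∀ i, PolishSpace (X i)] [∀ i, BorelSpace (X i)] [∀ i, Nonempty (X i)] {n : ℕ}

theorem measurable_frontFun_coordFun {i : ℕ} (h : i ≤ n) :
    Measurable fun ω : ∀ j : Fin n, X j => (frontFun i h ω, coordFun ω i) :=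
  (measurable_frontFun h).prodMk measurable_coordFun

theorem measurable_coordFun_coordFun {i k : ℕ} :
    Measurable fun ω : ∀ j : Fin n, X j => (coordFun ω i, coordFun ω k) :=
  measurable_coordFun.prodMk measurable_coordFun

variable (Q : Measure (∀ j : Fin n, X j))

theorem fst_frontPairMarg {i : ℕ} (hi : i < n) :
    (frontPairMarg Q i hi).fst = frontMarg Q i hi.le :=
  Measure.map_map measurable_fst (measurable_frontFun_coordFun hi.le)

theorem map_coordFun_frontMarg {i k : ℕ} (hi : i ≤ n) (hk : k < i) :
    (frontMarg Q i hi).map (fun ω => coordFun ω k) = singleMarg Q k := by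
  rw [frontMarg, Measure.map_map measurable_coordFun (measurable_frontFun hi)]
  exact congrArg (Q.map ·) (funext (coordFun_frontFun hi hk))

theorem map_coordFun_frontPairMarg {i : ℕ} (hi₀ : 0 < i) (hi : i < n) :
    (frontPairMarg Q i hi).map (fun p => (coordFun p.1 (i - 1), p.2)) = adjMarg Q i := by
  have hg : Measurable fun p : (∀ j : Fin i, X j) × X i => (coordFun p.1 (i - 1), p.2) :=
    (measurable_coordFun.comp measurable_fst).prodMk measurable_snd
  rw [frontPairMarg, Measure.map_map hg (measurable_frontFun_coordFun hi.le)]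
  exact congrArg (Q.map ·) (funext fun ω =>
    Prod.ext (coordFun_frontFun hi.le (Nat.sub_lt hi₀ one_pos) ω) rfl)

theorem frontPairMarg_eq_map_frontMarg {i : ℕ} (hi : i < n) :
    frontPairMarg Q i hi = (frontMarg Q (i + 1) hi).map
      fun ω => (frontFun i i.le_succ ω, coordFun ω i) := by
  rw [frontMarg, Measure.map_map (measurable_frontFun_coordFun i.le_succ) (measurable_frontFun hi)]
  exact congrArg (Q.map ·) (funext fun ω =>
    Prod.ext rfl (coordFun_frontFun hi i.lt_succ_self ω).symm)

theorem measurableEmbedding_frontFun_coordFun (i : ℕ) :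
    MeasurableEmbedding fun ω : ∀ j : Fin (i + 1), X j => (frontFun i i.le_succ ω, coordFun ω i) :=
  (measurable_frontFun_coordFun i.le_succ).measurableEmbedding fun ω η h => by
    simp only [Prod.mk.injEq, coordFun, dif_pos i.lt_succ_self] at h
    exact funext (Fin.lastCases h.2 fun j => congrFun h.1 j)

theorem measurableEmbedding_coordFun_zero_one :
    MeasurableEmbedding fun ω : ∀ j : Fin 2, X j => (coordFun ω 0, coordFun ω 1) :=
  measurable_coordFun_coordFun.measurableEmbedding fun ω η h => by
    simp only [Prod.mk.injEq, coordFun, dif_pos zero_lt_two, dif_pos one_lt_two] at h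
    exact funext (Fin.forall_fin_two.2 h)

theorem map_coordFun_frontMarg_two (h : 2 ≤ n) :
    (frontMarg Q 2 h).map (fun ω => (coordFun ω 0, coordFun ω 1)) = pairMarg Q 0 := by
  rw [frontMarg, Measure.map_map measurable_coordFun_coordFun (measurable_frontFun h)]
  exact congrArg (Q.map ·) (funext fun ω => Prod.ext
    (coordFun_frontFun h zero_lt_two ω) (coordFun_frontFun h one_lt_two ω))

variable (P R : Measure (∀ j : Fin n, X j)) [IsFiniteMeasure P] [IsFiniteMeasure R]

theorem klDiv_frontPairMarg {i : ℕ} (hi : i < n) :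
    klDiv (frontPairMarg P i hi) (frontPairMarg R i hi) =
      klDiv (frontMarg P (i + 1) hi) (frontMarg R (i + 1) hi) := by
  rw [frontPairMarg_eq_map_frontMarg, frontPairMarg_eq_map_frontMarg,
    klDiv_map_of_measurableEmbedding (measurableEmbedding_frontFun_coordFun i)]

/-- The relative entropy of the law of the first `i + 1` coordinates with respect to its
Markovian counterpart, in which the `i`-th coordinate depends only on the previous one. -/
def markovDefect (i : ℕ) : ℝ≥0∞ :=
  if hi : i < n then
    klDiv (frontPairMarg P i hi) (frontMarg P i hi.le ⊗ₘ (adjMarg P i).condKernel.comap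
      (fun x : ∀ j : Fin i, X j => coordFun x (i - 1)) measurable_coordFun)
  else 0

theorem isMarkovian_iff_markovDefect :
    IsMarkovian P ↔ ∀ i ∈ Finset.Ico 2 n, markovDefect P i = 0 := by
  simp only [IsMarkovian, Finset.mem_Ico, and_imp]
  refine forall₃_congr fun i _ hi => ?_
  rw [markovDefect, dif_pos hi, klDiv_eq_zero_iff]

variable {R} in
theorem IsMarkovian.klDiv_frontMarg_succ_add (hR : IsMarkovian R) {i : ℕ} (hi₂ : 2 ≤ i)
    (hi : i < n) :
    klDiv (frontMarg P (i + 1) hi) (frontMarg R (i + 1) hi) +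
        klDiv (singleMarg P (i - 1)) (singleMarg R (i - 1)) =
      klDiv (adjMarg P i) (adjMarg R i) + klDiv (frontMarg P i hi.le) (frontMarg R i hi.le) +
        markovDefect P i := by
  have h := klDiv_add_klDiv_map_fst_eq (frontPairMarg P i hi) (frontPairMarg R i hi)
    (measurable_coordFun (i := i - 1)) (adjMarg R i).condKernel
    (by rw [fst_frontPairMarg]; exact hR i hi₂ hi)
  have hlt : i - 1 < i := by omega
  simp only [map_coordFun_frontPairMarg _ (zero_lt_two.trans_le hi₂)] at h
  rw [fst_frontPairMarg, fst_frontPairMarg, map_coordFun_frontMarg _ _ hlt,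
    map_coordFun_frontMarg _ _ hlt, klDiv_frontPairMarg] at h
  rw [markovDefect, dif_pos hi]
  exact h

variable {R} in
theorem IsMarkovian.klDiv_frontMarg_add_sum (hR : IsMarkovian R) {k : ℕ} (hk₁ : 1 ≤ k)
    (hk : k < n) :
    klDiv (frontMarg P (k + 1) hk) (frontMarg R (k + 1) hk) +
        ∑ i ∈ Finset.Ico 1 k, klDiv (singleMarg P i) (singleMarg R i) =
      ∑ i ∈ Finset.range k, klDiv (pairMarg P i) (pairMarg R i) +
        ∑ i ∈ Finset.Ico 2 (k + 1), markovDefect P i := by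
  induction k, hk₁ using Nat.le_induction with
  | base =>
    rw [← klDiv_map_of_measurableEmbedding measurableEmbedding_coordFun_zero_one,
      map_coordFun_frontMarg_two, map_coordFun_frontMarg_two]
    simp
  | succ k hk₁ ih =>
    have hstep : klDiv (frontMarg P (k + 1 + 1) hk) (frontMarg R (k + 1 + 1) hk) +
        klDiv (singleMarg P k) (singleMarg R k) =
      klDiv (pairMarg P k) (pairMarg R k) +
        klDiv (frontMarg P (k + 1) hk.le) (frontMarg R (k + 1) hk.le) + markovDefect P (k + 1) :=
      hR.klDiv_frontMarg_succ_add P (by omega) hk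
    rw [Finset.sum_Ico_succ_top hk₁, Finset.sum_range_succ,
      Finset.sum_Ico_succ_top (show 2 ≤ k + 1 by omega), add_comm (∑ i ∈ Finset.Ico 1 k, _),
      ← add_assoc, hstep, add_right_comm, add_assoc (klDiv (pairMarg P k) _), ih]
    ring

end Marginals

set_option synthInstance.maxHeartbeats 1000000 in
set_option maxHeartbeats 1000000 in
/-- Lemma `lemmarkov`, equality case: if `R` is Markovian and
`H(P|R) < ∞`, then `H(P|R) = ∑_{i=1}^{n-1} H(P_{i,i+1}|R_{i,i+1}) - ∑_{i=2}^{n-1} H(P_i|R_i)`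
(stated in the equivalent rearranged form) holds if and only if `P` is itself Markovian,
i.e. `P = P_{1,2} ∘ P_{2,3} ∘ ⋯ ∘ P_{n-1,n}`. -/
theorem relEnt_eq_sum_iff_isMarkovian
    {X : ℕ → Type*} [∀ i, MeasurableSpace (X i)] [∀ i, TopologicalSpace (X i)]
    [∀ i, PolishSpace (X i)] [∀ i, BorelSpace (X i)] [∀ i, Nonempty (X i)]
    (n : ℕ) (hn : 3 ≤ n) (P R : Measure (∀ j : Fin n, X j))
    [IsProbabilityMeasure P] [IsProbabilityMeasure R]
    (hR : IsMarkovian R) (hPR : relEnt P R < ⊤) :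
    (relEnt P R + ∑ i ∈ Finset.Ico 1 (n - 1), relEnt (singleMarg P i) (singleMarg R i) =
        ∑ i ∈ Finset.range (n - 1), relEnt (pairMarg P i) (pairMarg R i)) ↔
      IsMarkovian P := by
  have hP₁ (i : ℕ) : IsProbabilityMeasure (singleMarg P i) :=
    Measure.isProbabilityMeasure_map measurable_coordFun.aemeasurable
  have hR₁ (i : ℕ) : IsProbabilityMeasure (singleMarg R i) :=
    Measure.isProbabilityMeasure_map measurable_coordFun.aemeasurable
  have hP₂ (i : ℕ) : IsProbabilityMeasure (pairMarg P i) :=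
    Measure.isProbabilityMeasure_map measurable_coordFun_coordFun.aemeasurable
  have hR₂ (i : ℕ) : IsProbabilityMeasure (pairMarg R i) :=
    Measure.isProbabilityMeasure_map measurable_coordFun_coordFun.aemeasurable
  simp only [relEnt_eq_klDiv] at hPR ⊢
  have hfin : InformationTheory.klDiv P R < ⊤ := by
    rwa [← EReal.coe_ennreal_lt_coe_ennreal_iff]
  have hpair : ∑ i ∈ Finset.range (n - 1),
      InformationTheory.klDiv (pairMarg P i) (pairMarg R i) ≠ ⊤ :=
    ENNReal.sum_ne_top.2 fun i _ =>
      ((InformationTheory.klDiv_map_le P R measurable_coordFun_coordFun).trans_lt hfin).ne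
  obtain ⟨k, rfl⟩ : ∃ k, n = k + 1 := ⟨n - 1, by omega⟩
  have hsum := hR.klDiv_frontMarg_add_sum P (k := k) (by omega) k.lt_succ_self
  rw [frontMarg_self, frontMarg_self] at hsum
  have hcoe (s : Finset ℕ) (f : ℕ → ℝ≥0∞) :
      ∑ i ∈ s, (f i : EReal) = ((∑ i ∈ s, f i : ℝ≥0∞) : EReal) :=
    (map_sum (⟨⟨(↑), rfl⟩, EReal.coe_ennreal_add⟩ : ℝ≥0∞ →+ EReal) f s).symm
  rw [isMarkovian_iff_markovDefect, ← Finset.sum_eq_zero_iff, hcoe, hcoe,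
    ← EReal.coe_ennreal_add, EReal.coe_ennreal_eq_coe_ennreal_iff, Nat.add_sub_cancel, hsum]
  rw [Nat.add_sub_cancel] at hpair
  exact ⟨fun h => (ENNReal.add_right_inj hpair).1 (h.trans (add_zero _).symm),
    fun h => by rw [h, add_zero]⟩
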